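/- Let (T, 𝒯, λ) be a complete atomless probability space, ℱ ⊆ 𝒯 a sub-σ-algebra, and X an infinite Polish space. Then 𝒯 is nowhere equivalent to ℱ if and only if for every sub-σ-algebra 𝒢 ⊆ ℱ, every closed-valued ℱ-measurable correspondence F : T ⇉ X, every pair f₁, f₂ of 𝒯-measurable selections of F, and every α ∈ (0,1), there exists a 𝒯-measurable selection f of F with λ(A ∩ f⁻¹(B)) = α·λ(A ∩ f₁⁻¹(B)) + (1−α)·λ(A ∩ f₂⁻¹(B)) for every Borel B ⊆ X and every A ∈ 𝒢 (i.e., the set of regular conditional distributions given 𝒢 of 𝒯-measurable selections of F is convex). -/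

import Mathlib

open MeasureTheory Set Filter Topology ENNReal

section Splitting

variable {T S : Type*} [MeasurableSpace T] [MeasurableSpace S]

/-- `μ` is nowhere equivalent to the σ-algebra pulled back along `π`: every non-null set has a
measurable subset that is not, up to null sets, the trace of a pulled back set. -/
def NowhereEquivalentAlong (μ : Measure T) (π : T → S) : Prop :=
  ∀ D : Set T, MeasurableSet D → 0 < μ D → ∃ D₀ ⊆ D, MeasurableSet D₀ ∧
    ∀ E : Set S, MeasurableSet E → 0 < μ (symmDiff D₀ (D ∩ π ⁻¹' E))

/-- A class of sets closed under countable increasing unions has an element that is maximal in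
measure among its supersets in the class. -/
theorem exists_measure_maximal (μ : Measure T) [IsFiniteMeasure μ] (P : Set T → Prop)
    (h_empty : P ∅) (h_union : ∀ s : ℕ → Set T, Monotone s → (∀ n, P (s n)) → P (⋃ n, s n)) :
    ∃ s, P s ∧ ∀ s', P s' → s ⊆ s' → μ s' ≤ μ s := by
  have step : ∀ (n : ℕ) (s : {s // P s}), ∃ s' : {s // P s}, s.1 ⊆ s'.1 ∧
      ∀ s'', P s'' → s.1 ⊆ s'' → μ s'' ≤ μ s'.1 + ((n : ℝ≥0∞) + 1)⁻¹ := by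
    intro n s
    set M : ℝ≥0∞ := ⨆ s' : {s' // P s' ∧ s.1 ⊆ s'}, μ s'.1 with hM
    have hle : ∀ s'', P s'' → s.1 ⊆ s'' → μ s'' ≤ M := fun s'' h h' =>
      le_iSup (fun s' : {s' // P s' ∧ s.1 ⊆ s'} => μ s'.1) ⟨s'', h, h'⟩
    have hMfin : M ≠ ∞ :=
      ne_top_of_le_ne_top (measure_ne_top μ univ) (iSup_le fun s' => measure_mono (subset_univ _))
    rcases eq_or_ne M 0 with h0 | h0
    · exact ⟨s, subset_rfl, fun s'' h h' => (hle s'' h h').trans (by simp [h0])⟩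
    · have hlt : M - ((n : ℝ≥0∞) + 1)⁻¹ < M :=
        ENNReal.sub_lt_self hMfin h0 (by simp)
      obtain ⟨s', hs'⟩ := lt_iSup_iff.1 (hM ▸ hlt)
      exact ⟨⟨s'.1, s'.2.1⟩, s'.2.2, fun s'' h h' =>
        (hle s'' h h').trans (tsub_le_iff_right.1 hs'.le)⟩
  choose next h_sub h_next using step
  let s : ℕ → {s // P s} := fun n => Nat.rec ⟨∅, h_empty⟩ next n
  have hmono : Monotone fun n => (s n).1 := monotone_nat_of_le_succ fun n => h_sub n (s n)
  refine ⟨⋃ n, (s n).1, h_union _ hmono fun n => (s n).2, fun s' hs' hsub => ?_⟩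
  have key : ∀ n : ℕ, μ s' ≤ μ (⋃ n, (s n).1) + ((n : ℝ≥0∞) + 1)⁻¹ := fun n =>
    (h_next n (s n) s' hs' ((subset_iUnion (fun n => (s n).1) n).trans hsub)).trans
      (add_le_add_left (measure_mono (subset_iUnion (fun n => (s n).1) (n + 1))) _)
  have hlim : Tendsto (fun n : ℕ => ((n : ℝ≥0∞) + 1)⁻¹) atTop (𝓝 0) := by
    have := (tendsto_add_atTop_iff_nat 1).2 ENNReal.tendsto_inv_nat_nhds_zero
    simpa using this
  have := tendsto_const_nhds (x := μ (⋃ n, (s n).1)).add hlim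
  rw [add_zero] at this
  exact ge_of_tendsto' this key

/-- The image under `π` of the restriction of `μ` to `D`. -/
noncomputable def fiberMass (μ : Measure T) (π : T → S) (D : Set T) : Measure S :=
  (μ.restrict D).map π

instance (μ : Measure T) [IsFiniteMeasure μ] (π : T → S) (D : Set T) :
    IsFiniteMeasure (fiberMass μ π D) := by
  unfold fiberMass; infer_instance

variable {μ : Measure T} {π : T → S}

theorem fiberMass_apply (hπ : Measurable π) (D : Set T) {A : Set S} (hA : MeasurableSet A) :
    fiberMass μ π D A = μ (π ⁻¹' A ∩ D) := by
  rw [fiberMass, Measure.map_apply hπ hA, Measure.restrict_apply (hπ hA)]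

theorem fiberMass_univ (hπ : Measurable π) (D : Set T) : fiberMass μ π D univ = μ D := by
  simp [fiberMass_apply hπ D MeasurableSet.univ]

theorem fiberMass_add_diff (hπ : Measurable π) {D D₀ : Set T} (hD₀ : MeasurableSet D₀)
    (h : D₀ ⊆ D) : fiberMass μ π D₀ + fiberMass μ π (D \ D₀) = fiberMass μ π D := by
  ext A hA
  rw [Measure.add_apply, fiberMass_apply hπ _ hA, fiberMass_apply hπ _ hA, fiberMass_apply hπ _ hA,
    ← measure_inter_add_sdiff (π ⁻¹' A ∩ D) hD₀, inter_assoc, inter_eq_right.2 h, inter_sdiff_assoc]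

theorem fiberMass_inter_preimage_apply (hπ : Measurable π) (D : Set T) {A E : Set S}
    (hA : MeasurableSet A) (hE : MeasurableSet E) :
    fiberMass μ π (D ∩ π ⁻¹' E) A = fiberMass μ π D (A ∩ E) := by
  rw [fiberMass_apply hπ _ hA, fiberMass_apply hπ _ (hA.inter hE)]
  congr 1
  ext t
  simp only [mem_inter_iff, mem_preimage]
  tauto

/-- A non-null set contains a non-null set carrying at most half of the mass of every fiber. -/
theorem NowhereEquivalentAlong.exists_two_smul_fiberMass_le [IsFiniteMeasure μ]
    (h : NowhereEquivalentAlong μ π) (hπ : Measurable π) {D : Set T} (hD : MeasurableSet D)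
    (hpos : 0 < μ D) :
    ∃ D' ⊆ D, MeasurableSet D' ∧ 0 < μ D' ∧ (2 : ℝ≥0∞) • fiberMass μ π D' ≤ fiberMass μ π D := by
  obtain ⟨D₀, hsub, hD₀, hne⟩ := h D hD hpos
  have hadd := fiberMass_add_diff (μ := μ) hπ hD₀ hsub
  obtain ⟨E, hE, h1, h2⟩ := hahn_decomposition (fiberMass μ π (D \ D₀)) (fiberMass μ π D₀)
  have bound : ∀ (B : Set T) (C : Set S), MeasurableSet C →
      (∀ A, MeasurableSet A →
        (2 : ℝ≥0∞) * fiberMass μ π B (A ∩ C) ≤ fiberMass μ π D (A ∩ C)) →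
      (2 : ℝ≥0∞) • fiberMass μ π (B ∩ π ⁻¹' C) ≤ fiberMass μ π D := by
    intro B C hC hB
    refine Measure.le_iff.2 fun A hA => ?_
    rw [Measure.smul_apply, fiberMass_inter_preimage_apply hπ _ hA hC, smul_eq_mul]
    exact (hB A hA).trans (measure_mono inter_subset_left)
  by_cases c1 : 0 < μ (D₀ ∩ π ⁻¹' E)
  · refine ⟨_, inter_subset_left.trans hsub, hD₀.inter (hπ hE), c1, bound _ _ hE fun A hA => ?_⟩
    rw [← hadd, Measure.add_apply, two_mul]
    exact add_le_add_right (h1 _ (hA.inter hE) inter_subset_right) _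
  by_cases c2 : 0 < μ ((D \ D₀) ∩ π ⁻¹' Eᶜ)
  · refine ⟨_, inter_subset_left.trans sdiff_subset, (hD.diff hD₀).inter (hπ hE.compl), c2,
      bound _ _ hE.compl fun A hA => ?_⟩
    rw [← hadd, Measure.add_apply, two_mul]
    exact add_le_add_left (h2 _ (hA.inter hE.compl) inter_subset_right) _
  · refine absurd (hne Eᶜ hE.compl) (not_lt.2 ?_)
    calc μ (symmDiff D₀ (D ∩ π ⁻¹' Eᶜ))
        ≤ μ ((D₀ ∩ π ⁻¹' E) ∪ ((D \ D₀) ∩ π ⁻¹' Eᶜ)) := by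
          refine measure_mono fun t ht => ?_
          simp only [mem_symmDiff, mem_inter_iff, mem_preimage, mem_compl_iff, mem_union,
            Set.mem_sdiff] at ht ⊢
          have := @hsub t
          tauto
      _ ≤ 0 := (measure_union_le _ _).trans (by
          rw [nonpos_iff_eq_zero.1 (not_lt.1 c1), nonpos_iff_eq_zero.1 (not_lt.1 c2), add_zero])

theorem NowhereEquivalentAlong.exists_fiberMass_le_smul [IsFiniteMeasure μ]
    (h : NowhereEquivalentAlong μ π) (hπ : Measurable π) {D : Set T} (hD : MeasurableSet D)
    (hpos : 0 < μ D) {ε : ℝ≥0∞} (hε : ε ≠ 0) :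
    ∃ D' ⊆ D, MeasurableSet D' ∧ 0 < μ D' ∧ fiberMass μ π D' ≤ ε • fiberMass μ π D := by
  have iter : ∀ k : ℕ, ∃ D' ⊆ D, MeasurableSet D' ∧ 0 < μ D' ∧
      fiberMass μ π D' ≤ ((2 : ℝ≥0∞)⁻¹ ^ k) • fiberMass μ π D := by
    intro k
    induction k with
    | zero => exact ⟨D, subset_rfl, hD, hpos, by simp⟩
    | succ k ih =>
      obtain ⟨D₁, hsub₁, hD₁, hpos₁, hle₁⟩ := ih
      obtain ⟨D₂, hsub₂, hD₂, hpos₂, hle₂⟩ := h.exists_two_smul_fiberMass_le hπ hD₁ hpos₁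
      refine ⟨D₂, hsub₂.trans hsub₁, hD₂, hpos₂, Measure.le_iff.2 fun A hA => ?_⟩
      have e₁ := hle₁ A
      have e₂ := hle₂ A
      simp only [Measure.smul_apply, smul_eq_mul] at e₁ e₂ ⊢
      calc fiberMass μ π D₂ A = 2⁻¹ * (2 * fiberMass μ π D₂ A) := by
            rw [← mul_assoc, ENNReal.inv_mul_cancel (by simp) (by simp), one_mul]
        _ ≤ 2⁻¹ * (2⁻¹ ^ k * fiberMass μ π D A) := mul_le_mul_right (e₂.trans e₁) _
        _ = 2⁻¹ ^ (k + 1) * fiberMass μ π D A := by rw [pow_succ']; ring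
  obtain ⟨k, hk⟩ := ENNReal.exists_inv_two_pow_lt hε
  obtain ⟨D', hsub, hD', hpos', hle⟩ := iter k
  refine ⟨D', hsub, hD', hpos', hle.trans (Measure.le_iff.2 fun A _ => ?_)⟩
  simp only [Measure.smul_apply, smul_eq_mul]
  gcongr

/-- If `μ` is nowhere equivalent along `π`, every measure below the fiber mass of `D` is the fiber
mass of a measurable subset of `D`. -/
theorem NowhereEquivalentAlong.exists_fiberMass_eq [IsFiniteMeasure μ]
    (h : NowhereEquivalentAlong μ π) (hπ : Measurable π) {D : Set T} (hD : MeasurableSet D)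
    {ν : Measure S} (hν : ν ≤ fiberMass μ π D) :
    ∃ D' ⊆ D, MeasurableSet D' ∧ fiberMass μ π D' = ν := by
  have : IsFiniteMeasure ν := isFiniteMeasure_of_le _ hν
  obtain ⟨D', ⟨hsub, hD', hle⟩, hmax⟩ := exists_measure_maximal μ
    (fun s => s ⊆ D ∧ MeasurableSet s ∧ fiberMass μ π s ≤ ν)
    ⟨empty_subset _, MeasurableSet.empty, by simp [fiberMass, Measure.zero_le]⟩ (by
      intro s hs hP
      refine ⟨iUnion_subset fun n => (hP n).1, MeasurableSet.iUnion fun n => (hP n).2.1,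
        Measure.le_iff.2 fun A hA => ?_⟩
      rw [fiberMass_apply hπ _ hA, inter_iUnion,
        Monotone.measure_iUnion fun i j hij => inter_subset_inter_right _ (hs hij)]
      exact iSup_le fun n => by
        rw [← fiberMass_apply hπ _ hA]
        exact (hP n).2.2 A)
  refine ⟨D', hsub, hD', ?_⟩
  by_contra hne
  have hlt : μ D' < ν univ := by
    rw [← fiberMass_univ hπ]
    refine lt_of_le_of_ne (hle _) fun heq => hne ?_
    exact Measure.eq_of_le_of_measure_univ_eq hle heq
  obtain ⟨ε, hε0, hε⟩ : ∃ ε : ℝ≥0∞, 0 < ε ∧ μ D' + ε * μ univ < ν univ := by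
    have hc : Tendsto (fun ε : ℝ≥0∞ => μ D' + ε * μ univ) (𝓝[>] 0) (𝓝 (μ D')) := by
      have : Tendsto (fun ε : ℝ≥0∞ => μ D' + ε * μ univ) (𝓝 0) (𝓝 (μ D' + 0 * μ univ)) :=
        tendsto_const_nhds.add (ENNReal.Tendsto.mul_const tendsto_id (Or.inr (measure_ne_top _ _)))
      rw [zero_mul, add_zero] at this
      exact this.mono_left nhdsWithin_le_nhds
    obtain ⟨ε, h1, h2⟩ := ((hc.eventually_lt_const hlt).and self_mem_nhdsWithin).exists
    exact ⟨ε, h2, h1⟩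
  have hεtop : ε * μ univ ≠ ∞ := fun hh => by simp [hh] at hε
  have : IsFiniteMeasure (ε • fiberMass μ π univ) :=
    ⟨by rw [Measure.smul_apply, fiberMass_univ hπ]; exact lt_top_iff_ne_top.2 hεtop⟩
  obtain ⟨E, hE, h1, h2⟩ := hahn_decomposition ν (fiberMass μ π D' + ε • fiberMass μ π univ)
  have hposE : 0 < μ ((D \ D') ∩ π ⁻¹' E) := by
    by_contra h0
    refine absurd hε (not_lt.2 ?_)
    have hνE : ν E ≤ fiberMass μ π D' E := by
      refine (hν E).trans ?_
      rw [← fiberMass_add_diff hπ hD' hsub, Measure.add_apply, fiberMass_apply hπ (D \ D') hE,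
        inter_comm (π ⁻¹' E), nonpos_iff_eq_zero.1 (not_lt.1 h0), add_zero]
    calc ν univ = ν E + ν Eᶜ := (measure_add_measure_compl hE).symm
      _ ≤ fiberMass μ π D' E + (fiberMass μ π D' + ε • fiberMass μ π univ) Eᶜ :=
          add_le_add hνE (h2 _ hE.compl subset_rfl)
      _ = fiberMass μ π D' univ + ε * fiberMass μ π univ Eᶜ := by
          rw [Measure.add_apply, ← add_assoc, measure_add_measure_compl hE, Measure.smul_apply,
            smul_eq_mul]
      _ ≤ μ D' + ε * μ univ := by
          rw [fiberMass_univ hπ]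
          gcongr
          exact (measure_mono (subset_univ _)).trans (fiberMass_univ hπ _).le
  obtain ⟨R, hRsub, hR, hRpos, hRle⟩ := h.exists_fiberMass_le_smul hπ
    ((hD.diff hD').inter (hπ hE)) hposE hε0.ne'
  have hdisj : Disjoint D' R :=
    (disjoint_sdiff_right (s := D') (t := D)).mono_right (hRsub.trans inter_subset_left)
  have hadd : fiberMass μ π D' + fiberMass μ π R = fiberMass μ π (D' ∪ R) := by
    rw [← fiberMass_add_diff hπ hD' subset_union_left, union_sdiff_cancel_left hdisj.inter_eq.le]
  refine absurd (hmax (D' ∪ R) ⟨union_subset hsub (hRsub.trans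
    (inter_subset_left.trans sdiff_subset)), hD'.union hR, ?_⟩ subset_union_left) (not_le.2 ?_)
  · rw [← hadd]
    refine Measure.le_iff.2 fun A hA => ?_
    have hRA : fiberMass μ π R A ≤ ε * fiberMass μ π univ (A ∩ E) := by
      refine (hRle A).trans ?_
      rw [Measure.smul_apply, smul_eq_mul, fiberMass_inter_preimage_apply hπ _ hA hE,
        fiberMass_apply hπ _ (hA.inter hE), fiberMass_apply hπ _ (hA.inter hE)]
      gcongr
      exact subset_univ _
    calc (fiberMass μ π D' + fiberMass μ π R) A
        ≤ fiberMass μ π D' A + ε * fiberMass μ π univ (A ∩ E) := by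
          rw [Measure.add_apply]; gcongr
      _ = (fiberMass μ π D' + ε • fiberMass μ π univ) (A ∩ E) + fiberMass μ π D' (A \ E) := by
          rw [← measure_inter_add_sdiff A hE, Measure.add_apply, Measure.smul_apply, smul_eq_mul]
          ring
      _ ≤ ν (A ∩ E) + ν (A \ E) := add_le_add (h1 _ (hA.inter hE) inter_subset_right) (hle _)
      _ = ν A := measure_inter_add_sdiff A hE
  · rw [measure_union hdisj hR]
    exact ENNReal.lt_add_right (measure_ne_top _ _) hRpos.ne'

end Splitting

section BooleanSequences

/-- The first `n` terms of a Boolean sequence, latest term first. -/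
def prefixWord (x : ℕ → Bool) : ℕ → List Bool
  | 0 => []
  | n + 1 => x n :: prefixWord x n

/-- The Boolean sequences whose first terms form the word `l`. -/
def wordCylinder (l : List Bool) : Set (ℕ → Bool) :=
  {x | prefixWord x l.length = l}

theorem length_prefixWord (x : ℕ → Bool) (n : ℕ) : (prefixWord x n).length = n := by
  induction n with
  | zero => rfl
  | succ n ih => simp [prefixWord, ih]

theorem prefixWord_eq_of_le {x y : ℕ → Bool} {m n : ℕ} (hmn : m ≤ n)
    (h : prefixWord x n = prefixWord y n) : prefixWord x m = prefixWord y m := by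
  induction n, hmn using Nat.le_induction with
  | base => exact h
  | succ n _ ih => exact ih (List.cons.inj h).2

theorem mem_wordCylinder_cons {b : Bool} {l : List Bool} {x : ℕ → Bool} :
    x ∈ wordCylinder (b :: l) ↔ x l.length = b ∧ x ∈ wordCylinder l := by
  simp [wordCylinder, prefixWord]

theorem wordCylinder_nil : wordCylinder [] = univ := by
  simp [wordCylinder, prefixWord]

theorem measurableSet_wordCylinder (l : List Bool) : MeasurableSet (wordCylinder l) := by
  induction l with
  | nil => simp [wordCylinder_nil]
  | cons b l ih =>
    have : wordCylinder (b :: l) = (fun x : ℕ → Bool => x l.length) ⁻¹' {b} ∩ wordCylinder l := by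
      ext x
      exact mem_wordCylinder_cons
    rw [this]
    exact (measurable_pi_apply l.length (measurableSet_singleton b)).inter ih

theorem isPiSystem_range_wordCylinder : IsPiSystem (range wordCylinder) := by
  have key : ∀ l l' : List Bool, l.length ≤ l'.length →
      (wordCylinder l ∩ wordCylinder l').Nonempty →
        wordCylinder l ∩ wordCylinder l' = wordCylinder l' := by
    rintro l l' hle ⟨x, hx, hx'⟩
    refine inter_eq_right.2 fun y hy => ?_
    have hyx : prefixWord y l'.length = prefixWord x l'.length := Eq.trans hy (Eq.symm hx')
    exact (prefixWord_eq_of_le hle hyx).trans hx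
  rintro _ ⟨l, rfl⟩ _ ⟨l', rfl⟩ hne
  rcases le_total l.length l'.length with h | h
  · exact ⟨l', (key l l' h hne).symm⟩
  · rw [inter_comm] at hne ⊢
    exact ⟨l, (key l' l h hne).symm⟩

theorem generateFrom_range_wordCylinder :
    (MeasurableSpace.pi : MeasurableSpace (ℕ → Bool)) =
      MeasurableSpace.generateFrom (range wordCylinder) := by
  refine le_antisymm ?_ (MeasurableSpace.generateFrom_le ?_)
  · refine iSup_le fun n => ?_
    refine Measurable.comap_le (@measurable_to_bool _ (_) _ ?_)
    have : (fun x : ℕ → Bool => x n) ⁻¹' {true}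
        = ⋃ l : {l : List Bool // l.length = n}, wordCylinder (true :: l.1) := by
      ext x
      simp only [mem_preimage, mem_singleton_iff, mem_iUnion, mem_wordCylinder_cons]
      constructor
      · intro hx
        refine ⟨⟨prefixWord x n, length_prefixWord x n⟩, ?_, ?_⟩
        · simpa [length_prefixWord] using hx
        · simp [wordCylinder, length_prefixWord]
      · rintro ⟨⟨l, rfl⟩, hx, -⟩
        exact hx
    rw [this]
    exact MeasurableSet.iUnion fun l => MeasurableSpace.measurableSet_generateFrom ⟨_, rfl⟩
  · rintro _ ⟨l, rfl⟩
    exact measurableSet_wordCylinder l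

end BooleanSequences

section Transport

variable {T S : Type*} [MeasurableSpace T] [MeasurableSpace S] {μ : Measure T} {π : T → S}

/-- A binary tree of subsets of `T` matching the fiber masses of the cylinders under `ν`. -/
theorem NowhereEquivalentAlong.exists_tree [IsFiniteMeasure μ]
    (h : NowhereEquivalentAlong μ π) (hπ : Measurable π) {ν : Measure (S × (ℕ → Bool))}
    [IsFiniteMeasure ν] (hν : ν.map Prod.fst = μ.map π) :
    ∃ D : List Bool → Set T, D [] = univ ∧ (∀ l, D (true :: l) ⊆ D l) ∧
      (∀ l, D (false :: l) = D l \ D (true :: l)) ∧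
      ∀ l, MeasurableSet (D l) ∧
        fiberMass μ π (D l) = fiberMass ν Prod.fst (Prod.snd ⁻¹' wordCylinder l) := by
  have hC : ∀ l, MeasurableSet (Prod.snd ⁻¹' wordCylinder l : Set (S × (ℕ → Bool))) :=
    fun l => measurable_snd (measurableSet_wordCylinder l)
  have hCsub : ∀ l, (Prod.snd ⁻¹' wordCylinder (true :: l) : Set (S × (ℕ → Bool))) ⊆
      Prod.snd ⁻¹' wordCylinder l := fun l x hx => (mem_wordCylinder_cons.1 hx).2
  have hCdiff : ∀ l, (Prod.snd ⁻¹' wordCylinder (false :: l) : Set (S × (ℕ → Bool))) =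
      Prod.snd ⁻¹' wordCylinder l \ Prod.snd ⁻¹' wordCylinder (true :: l) := by
    intro l
    ext x
    simp only [mem_preimage, Set.mem_sdiff, mem_wordCylinder_cons]
    cases x.2 l.length <;> simp
  let Q : List Bool → Set T → Prop := fun l s => MeasurableSet s ∧
    fiberMass μ π s = fiberMass ν Prod.fst (Prod.snd ⁻¹' wordCylinder l)
  have step : ∀ (l : List Bool) (s : {s // Q l s}), ∃ s', s' ⊆ s.1 ∧ Q (true :: l) s' := by
    rintro l ⟨s, hs, hsν⟩
    obtain ⟨s', hsub, hs', heq⟩ := h.exists_fiberMass_eq hπ hs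
      (ν := fiberMass ν Prod.fst (Prod.snd ⁻¹' wordCylinder (true :: l))) (by
        rw [hsν, ← fiberMass_add_diff measurable_fst (hC _) (hCsub l)]
        exact Measure.le_add_right le_rfl)
    exact ⟨s', hsub, hs', heq⟩
  choose next h_sub h_next using step
  have h_diff : ∀ l (s : {s // Q l s}), Q (false :: l) (s.1 \ next l s) := by
    intro l s
    refine ⟨s.2.1.diff (h_next l s).1, ?_⟩
    have e₁ := fiberMass_add_diff (μ := μ) hπ (h_next l s).1 (h_sub l s)
    have e₂ := fiberMass_add_diff (μ := ν) measurable_fst (hC _) (hCsub l)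
    rw [s.2.2, ← e₂, (h_next l s).2, ← hCdiff] at e₁
    ext A hA
    have e₃ := congrArg (fun m : Measure S => m A) e₁
    simp only [Measure.add_apply] at e₃
    exact (ENNReal.add_right_inj (measure_ne_top _ _)).1 e₃
  have h_nil : Q [] univ := by
    refine ⟨MeasurableSet.univ, ?_⟩
    simp [fiberMass, wordCylinder_nil, hν]
  let D : (l : List Bool) → {s // Q l s} := fun l =>
    List.rec ⟨univ, h_nil⟩ (fun b l s => match b with
      | true => ⟨next l s, h_next l s⟩
      | false => ⟨s.1 \ next l s, h_diff l s⟩) l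
  exact ⟨fun l => (D l).1, rfl, fun l => h_sub l (D l), fun l => rfl, fun l => (D l).2⟩

theorem NowhereEquivalentAlong.exists_map_prod_eq_boolSequence [IsFiniteMeasure μ]
    (h : NowhereEquivalentAlong μ π) (hπ : Measurable π) {ν : Measure (S × (ℕ → Bool))}
    [IsFiniteMeasure ν] (hν : ν.map Prod.fst = μ.map π) :
    ∃ f : T → ℕ → Bool, Measurable f ∧ μ.map (fun t => (π t, f t)) = ν := by
  classical
  obtain ⟨D, h_nil, h_true, h_false, hD⟩ := h.exists_tree hπ hν
  let f : T → ℕ → Bool := fun t n => decide (∃ l : List Bool, l.length = n ∧ t ∈ D (true :: l))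
  have hf : Measurable f := by
    refine measurable_pi_lambda _ fun n => measurable_to_bool ?_
    have : (fun t => f t n) ⁻¹' {true}
        = ⋃ l : {l : List Bool // l.length = n}, D (true :: l.1) := by
      ext t
      simp [f]
    rw [this]
    exact MeasurableSet.iUnion fun l => (hD _).1
  have hfD : ∀ (n : ℕ) (l : List Bool), l.length = n → ∀ t, f t ∈ wordCylinder l ↔ t ∈ D l := by
    intro n
    induction n with
    | zero =>
      intro l hl t
      simp [List.length_eq_zero_iff.1 hl, wordCylinder_nil, h_nil]
    | succ n ih =>
      rintro (_ | ⟨b, l⟩) hl t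
      · simp at hl
      have hl' : l.length = n := by simpa using hl
      rw [mem_wordCylinder_cons, ih l hl' t]
      have hbit : t ∈ D l → (f t l.length = true ↔ t ∈ D (true :: l)) := by
        intro ht
        simp only [f, decide_eq_true_eq]
        refine ⟨?_, fun h' => ⟨l, rfl, h'⟩⟩
        rintro ⟨l', hlen, ht'⟩
        have h1 : prefixWord (f t) l'.length = l' := (ih l' (hlen.trans hl') t).2 (h_true l' ht')
        have h2 : prefixWord (f t) l.length = l := (ih l hl' t).2 ht
        rw [hlen, h2] at h1
        rwa [h1]
      cases b with
      | true =>
        exact ⟨fun ⟨h1, h2⟩ => (hbit h2).1 h1, fun h1 => ⟨(hbit (h_true l h1)).2 h1, h_true l h1⟩⟩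
      | false =>
        rw [h_false, Set.mem_sdiff, ← Bool.not_eq_true]
        exact ⟨fun ⟨h1, h2⟩ => ⟨h2, fun h3 => h1 ((hbit h2).2 h3)⟩,
          fun ⟨h2, h3⟩ => ⟨fun h1 => h3 ((hbit h2).1 h1), h2⟩⟩
  have hmeas : Measurable fun t => (π t, f t) := hπ.prodMk hf
  refine ⟨f, hf, Measure.ext_prod fun {A B} hA hB => ?_⟩
  let m₁ : Measure (ℕ → Bool) := fiberMass (μ.map fun t => (π t, f t)) Prod.snd (Prod.fst ⁻¹' A)
  let m₂ : Measure (ℕ → Bool) := fiberMass ν Prod.snd (Prod.fst ⁻¹' A)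
  have hcyl : ∀ l, m₁ (wordCylinder l) = m₂ (wordCylinder l) := by
    intro l
    have e := congrArg (fun m : Measure S => m A) (hD l).2
    simp only [fiberMass_apply hπ _ hA, fiberMass_apply measurable_fst _ hA] at e
    have hl := measurableSet_wordCylinder l
    rw [fiberMass_apply measurable_snd _ hl, fiberMass_apply measurable_snd _ hl,
      Measure.map_apply hmeas ((measurable_snd hl).inter (measurable_fst hA)),
      inter_comm (Prod.snd ⁻¹' _) (Prod.fst ⁻¹' A), ← e, inter_comm (Prod.fst ⁻¹' A)]
    congr 1
    ext t
    simp only [mem_preimage, mem_inter_iff, hfD _ l rfl t, and_comm]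
  have hm : m₁ = m₂ := by
    refine ext_of_generate_finite _ generateFrom_range_wordCylinder isPiSystem_range_wordCylinder
      ?_ (wordCylinder_nil ▸ hcyl [])
    rintro _ ⟨l, rfl⟩
    exact hcyl l
  have e := congrArg (fun m : Measure (ℕ → Bool) => m B) hm
  simp only [m₁, m₂, fiberMass_apply measurable_snd _ hB] at e
  rwa [inter_comm (Prod.snd ⁻¹' B)] at e

/-- If `μ` is nowhere equivalent along `π`, every measure on `S × X` with the right first marginal
is the joint law of `π` and some measurable map into `X`. -/
theorem NowhereEquivalentAlong.exists_map_prod_eq [IsFiniteMeasure μ]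
    (h : NowhereEquivalentAlong μ π) (hπ : Measurable π) {X : Type*} [MeasurableSpace X]
    [StandardBorelSpace X] [Nonempty X] {ν : Measure (S × X)} [IsFiniteMeasure ν]
    (hν : ν.map Prod.fst = μ.map π) :
    ∃ f : T → X, Measurable f ∧ μ.map (fun t => (π t, f t)) = ν := by
  let e : X → ℕ → Bool := MeasurableSpace.mapNatBool X
  have he : Measurable e := MeasurableSpace.measurable_mapNatBool X
  have hemb : MeasurableEmbedding e :=
    he.measurableEmbedding (MeasurableSpace.injective_mapNatBool X)
  obtain ⟨g, hg, hge⟩ := hemb.exists_measurable_extend measurable_id fun _ => ‹Nonempty X›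
  have hgmap : Measurable (Prod.map id g : S × (ℕ → Bool) → S × X) := measurable_id.prodMap hg
  have hemap : Measurable (Prod.map id e : S × X → S × (ℕ → Bool)) := measurable_id.prodMap he
  obtain ⟨f, hf, hfν⟩ := h.exists_map_prod_eq_boolSequence hπ (ν := ν.map (Prod.map id e)) (by
    rw [Measure.map_map measurable_fst hemap, ← hν]
    rfl)
  refine ⟨g ∘ f, hg.comp hf, ?_⟩
  have e₁ := congrArg (Measure.map (Prod.map id g)) hfν
  rw [Measure.map_map hgmap hemap, Measure.map_map hgmap (hπ.prodMk hf), Prod.map_comp_map,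
    hge, Function.comp_id, Prod.map_id, Measure.map_id] at e₁
  exact e₁

/-- Convex combinations of the joint laws of `π` with two selections of `G` are again the joint law
of `π` with a selection of `G`. -/
theorem NowhereEquivalentAlong.exists_selection [IsProbabilityMeasure μ]
    (h : NowhereEquivalentAlong μ π) (hπ : Measurable π) {X : Type*} [MeasurableSpace X]
    [StandardBorelSpace X] [Nonempty X] {G : Set (S × X)} (hG : MeasurableSet G)
    {f₁ f₂ : T → X} (hf₁ : Measurable f₁) (hf₂ : Measurable f₂)
    (hG₁ : ∀ᵐ t ∂μ, (π t, f₁ t) ∈ G) (hG₂ : ∀ᵐ t ∂μ, (π t, f₂ t) ∈ G)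
    {α : ℝ≥0∞} (hα : α < 1) :
    ∃ f : T → X, Measurable f ∧ (∀ᵐ t ∂μ, (π t, f t) ∈ G) ∧
      ∀ B : Set X, MeasurableSet B → ∀ A : Set S, MeasurableSet A →
        μ (π ⁻¹' A ∩ f ⁻¹' B)
          = α * μ (π ⁻¹' A ∩ f₁ ⁻¹' B) + (1 - α) * μ (π ⁻¹' A ∩ f₂ ⁻¹' B) := by
  have hm₁ := hπ.prodMk hf₁
  have hm₂ := hπ.prodMk hf₂
  let ν : Measure (S × X) :=
    α • μ.map (fun t => (π t, f₁ t)) + (1 - α) • μ.map (fun t => (π t, f₂ t))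
  have hν : ∀ C : Set (S × X), MeasurableSet C →
      ν C = α * μ ((fun t => (π t, f₁ t)) ⁻¹' C) + (1 - α) * μ ((fun t => (π t, f₂ t)) ⁻¹' C) := by
    intro C hC
    simp only [ν, Measure.add_apply, Measure.smul_apply, smul_eq_mul, Measure.map_apply hm₁ hC,
      Measure.map_apply hm₂ hC]
  have : IsFiniteMeasure ν := ⟨by
    rw [hν _ MeasurableSet.univ]
    simp [add_tsub_cancel_of_le hα.le]⟩
  have hfst : ν.map Prod.fst = μ.map π := by
    ext A hA
    rw [Measure.map_apply measurable_fst hA, hν _ (measurable_fst hA), Measure.map_apply hπ hA]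
    change α * μ (π ⁻¹' A) + (1 - α) * μ (π ⁻¹' A) = _
    rw [← add_mul, add_tsub_cancel_of_le hα.le, one_mul]
  obtain ⟨f, hf, hfν⟩ := h.exists_map_prod_eq hπ hfst
  have hm := hπ.prodMk hf
  have key : ∀ C : Set (S × X), MeasurableSet C → μ ((fun t => (π t, f t)) ⁻¹' C)
      = α * μ ((fun t => (π t, f₁ t)) ⁻¹' C) + (1 - α) * μ ((fun t => (π t, f₂ t)) ⁻¹' C) := by
    intro C hC
    rw [← hν C hC, ← hfν, Measure.map_apply hm hC]
  refine ⟨f, hf, ?_, fun B hB A hA => key (A ×ˢ B) (hA.prod hB)⟩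
  have e := key Gᶜ hG.compl
  have e₁ : μ ((fun t => (π t, f₁ t)) ⁻¹' Gᶜ) = 0 := hG₁
  have e₂ : μ ((fun t => (π t, f₂ t)) ⁻¹' Gᶜ) = 0 := hG₂
  rw [e₁, e₂, mul_zero, mul_zero, add_zero] at e
  exact mem_ae_iff.2 e

end Transport

section Converse

/-- If, given the σ-algebra pulled back along `π`, a partition into `n` pieces is equidistributed,
then a set on which each piece is the trace of a pulled back set has measure at most `1 / n`. -/
theorem measure_le_inv_of_equidistributed {T S : Type*} [MeasurableSpace T] [MeasurableSpace S]
    {μ : Measure T} [IsProbabilityMeasure μ] {π : T → S} (hπ : Measurable π) {D : Set T}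
    {n : ℕ} {P : Fin n → Set T} (hdisj : Pairwise fun i j => μ (P i ∩ P j) = 0)
    (hcover : ∀ᵐ t ∂μ, ∃ i, t ∈ P i)
    (hP : ∀ i, ∀ A : Set S, MeasurableSet A → μ (π ⁻¹' A ∩ P i) = (n : ℝ≥0∞)⁻¹ * μ (π ⁻¹' A))
    (htrace : ∀ i, ∃ E : Set S, MeasurableSet E ∧ μ (symmDiff (D ∩ P i) (D ∩ π ⁻¹' E)) = 0) :
    μ D ≤ (n : ℝ≥0∞)⁻¹ := by
  choose E hE htrace using htrace
  have htr : ∀ᵐ t ∂μ, ∀ i, t ∈ D → (t ∈ P i ↔ π t ∈ E i) := by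
    refine ae_all_iff.2 fun i => mem_ae_iff.2 (measure_mono_null (fun t ht => ?_) (htrace i))
    simp only [mem_compl_iff, mem_ofPred_eq, mem_symmDiff, mem_inter_iff, mem_preimage] at ht ⊢
    tauto
  have hdis : ∀ᵐ t ∂μ, ∀ i j, i ≠ j → ¬ (t ∈ P i ∧ t ∈ P j) := by
    refine ae_all_iff.2 fun i => ae_all_iff.2 fun j => ?_
    by_cases hij : i = j
    · simp [hij]
    · refine mem_ae_iff.2 (measure_mono_null (fun t ht => ?_) (hdisj hij))
      simp only [mem_compl_iff, mem_ofPred_eq] at ht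
      exact by_contra fun h' => ht fun _ => h'
  let E' : Fin n → Set S := fun i => E i \ ⋃ j, ⋃ _ : j < i, E j
  have hE' : ∀ i, MeasurableSet (E' i) := fun i =>
    (hE i).diff (MeasurableSet.iUnion fun j => MeasurableSet.iUnion fun _ => hE j)
  have hE'disj : Pairwise fun i j => Disjoint (π ⁻¹' E' i) (π ⁻¹' E' j) := by
    intro i j hij
    refine Set.disjoint_left.2 fun t hi hj => ?_
    simp only [E', mem_preimage, Set.mem_sdiff, mem_iUnion, not_exists] at hi hj
    rcases lt_or_gt_of_ne hij with h | h
    · exact hj.2 i h hi.1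
    · exact hi.2 j h hj.1
  calc μ D ≤ μ (⋃ i, π ⁻¹' E' i ∩ P i) := by
        refine measure_mono_ae ?_
        filter_upwards [htr, hdis, hcover] with t h1 h2 ⟨i, hi⟩ ht
        refine mem_iUnion.2 ⟨i, ⟨(h1 i ht).1 hi, ?_⟩, hi⟩
        simp only [mem_iUnion, not_exists]
        exact fun j hj hmem => h2 j i hj.ne ⟨(h1 j ht).2 hmem, hi⟩
    _ ≤ ∑ i, μ (π ⁻¹' E' i ∩ P i) := measure_iUnion_fintype_le _ _
    _ = (n : ℝ≥0∞)⁻¹ * ∑ i, μ (π ⁻¹' E' i) := by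
        rw [Finset.mul_sum]
        exact Finset.sum_congr rfl fun i _ => hP i _ (hE' i)
    _ = (n : ℝ≥0∞)⁻¹ * μ (⋃ i, π ⁻¹' E' i) := by
        rw [measure_iUnion hE'disj fun i => hπ (hE' i), tsum_fintype]
    _ ≤ (n : ℝ≥0∞)⁻¹ := by
        calc _ ≤ (n : ℝ≥0∞)⁻¹ * 1 := by gcongr; exact prob_le_one
          _ = _ := mul_one _

end Converse

section Equidistribution

variable {T S : Type*} [MeasurableSpace T] [MeasurableSpace S] {μ : Measure T} {π : T → S}

/-- Convexity for constant finite-valued correspondences yields maps that are equidistributed, given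
the σ-algebra pulled back along `π`, over any number of points. -/
theorem exists_equidistributed {X : Type*} [MeasurableSpace X]
    [MeasurableSingletonClass X]
    (hconv : ∀ C : Set X, C.Finite → C.Nonempty → ∀ f₁ f₂ : T → X, Measurable f₁ → Measurable f₂ →
      (∀ᵐ t ∂μ, f₁ t ∈ C) → (∀ᵐ t ∂μ, f₂ t ∈ C) → ∀ α : ℝ≥0∞, 0 < α → α < 1 →
        ∃ f : T → X, Measurable f ∧ (∀ᵐ t ∂μ, f t ∈ C) ∧
          ∀ B : Set X, MeasurableSet B → ∀ A : Set S, MeasurableSet A →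
            μ (π ⁻¹' A ∩ f ⁻¹' B)
              = α * μ (π ⁻¹' A ∩ f₁ ⁻¹' B) + (1 - α) * μ (π ⁻¹' A ∩ f₂ ⁻¹' B))
    {x : ℕ → X} (hx : Function.Injective x) (n : ℕ) :
    ∃ f : T → X, Measurable f ∧ (∀ᵐ t ∂μ, ∃ i < n + 1, f t = x i) ∧
      ∀ i < n + 1, ∀ A : Set S, MeasurableSet A →
        μ (π ⁻¹' A ∩ f ⁻¹' {x i}) = ((n + 1 : ℕ) : ℝ≥0∞)⁻¹ * μ (π ⁻¹' A) := by
  induction n with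
  | zero =>
    refine ⟨fun _ => x 0, measurable_const, ae_of_all _ fun _ => ⟨0, by simp, rfl⟩, ?_⟩
    intro i hi A _
    obtain rfl : i = 0 := by omega
    simp
  | succ n ih =>
    obtain ⟨g, hg, hgx, hgA⟩ := ih
    have hN0 : ((n + 1 + 1 : ℕ) : ℝ≥0∞) ≠ 0 := by simp
    have hN : ((n + 1 + 1 : ℕ) : ℝ≥0∞) ≠ ∞ := ENNReal.natCast_ne_top _
    have hM0 : ((n + 1 : ℕ) : ℝ≥0∞) ≠ 0 := by simp
    have hM : ((n + 1 : ℕ) : ℝ≥0∞) ≠ ∞ := ENNReal.natCast_ne_top _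
    set α : ℝ≥0∞ := ((n + 1 : ℕ) : ℝ≥0∞) * ((n + 1 + 1 : ℕ) : ℝ≥0∞)⁻¹ with hα
    have hsum : α + ((n + 1 + 1 : ℕ) : ℝ≥0∞)⁻¹ = 1 := by
      calc α + ((n + 1 + 1 : ℕ) : ℝ≥0∞)⁻¹
          = ((n + 1 + 1 : ℕ) : ℝ≥0∞) * ((n + 1 + 1 : ℕ) : ℝ≥0∞)⁻¹ := by
            rw [hα, Nat.cast_succ (n + 1)]; ring
        _ = 1 := ENNReal.mul_inv_cancel hN0 hN
    have hinv : ((n + 1 + 1 : ℕ) : ℝ≥0∞)⁻¹ ≠ 0 := ENNReal.inv_ne_zero.2 hN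
    have hαtop : α ≠ ∞ := fun h => by simp [h] at hsum
    have hα1 : α < 1 := hsum ▸ ENNReal.lt_add_right hαtop hinv
    have hα0 : 0 < α := pos_iff_ne_zero.2 (mul_ne_zero hM0 hinv)
    have hsub : 1 - α = ((n + 1 + 1 : ℕ) : ℝ≥0∞)⁻¹ := by
      rw [← hsum]; exact ENNReal.add_sub_cancel_left hαtop
    obtain ⟨f, hf, hfx, hfA⟩ := hconv (x '' Iio (n + 1 + 1)) ((finite_Iio _).image x)
      ⟨x 0, 0, by simp, rfl⟩ g (fun _ => x (n + 1)) hg measurable_const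
      (by
        filter_upwards [hgx] with t ⟨i, hi, hti⟩
        exact ⟨i, hi.trans (Nat.lt_succ_self _), hti.symm⟩)
      (ae_of_all _ fun _ => ⟨n + 1, Nat.lt_succ_self _, rfl⟩) α hα0 hα1
    refine ⟨f, hf, ?_, fun i hi A hA => ?_⟩
    · filter_upwards [hfx] with t ⟨i, hi, hti⟩
      exact ⟨i, hi, hti.symm⟩
    · rw [hfA _ (measurableSet_singleton _) A hA, hsub]
      rcases Nat.lt_succ_iff_lt_or_eq.1 hi with hi' | rfl
      · have hne : x (n + 1) ∉ ({x i} : Set X) := fun h => hi'.ne' (hx h)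
        rw [hgA i hi' A hA, preimage_const_of_notMem hne, inter_empty, measure_empty, mul_zero,
          add_zero, ← mul_assoc, hα,
          mul_right_comm ((n + 1 : ℕ) : ℝ≥0∞) (((n + 1 + 1 : ℕ) : ℝ≥0∞)⁻¹),
          ENNReal.mul_inv_cancel hM0 hM, one_mul]
      · have h0 : μ (π ⁻¹' A ∩ g ⁻¹' {x (n + 1)}) = 0 := by
          refine measure_mono_null (fun t ht => ?_) hgx
          rintro ⟨i, hi', hti⟩
          exact hi'.ne (hx (hti.symm.trans ht.2))
        rw [h0, mul_zero, zero_add, preimage_const_of_mem (mem_singleton _), inter_univ]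

end Equidistribution

/-- (NE ⇔ B1) For a complete atomless probability space `(T, 𝒯, μ)`, sub-σ-algebra
`ℱ ⊆ 𝒯` and infinite Polish space `X`: `𝒯` is nowhere equivalent to `ℱ` iff the set
of regular conditional distributions given `𝒢` of `𝒯`-measurable selections is convex
for every sub-σ-algebra `𝒢 ⊆ ℱ` and every closed-valued `ℱ`-measurable correspondence
`F : T ⇉ X`. -/
theorem nowhereEquivalent_iff_convexity
    {T : Type*} [𝒯 : MeasurableSpace T] (μ : Measure T) [IsProbabilityMeasure μ]
    (hcomplete : μ.IsComplete)
    (hatomless : ∀ D : Set T, MeasurableSet[𝒯] D → 0 < μ D →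
      ∃ D₀ ⊆ D, MeasurableSet[𝒯] D₀ ∧ 0 < μ D₀ ∧ μ D₀ < μ D)
    (ℱ : MeasurableSpace T) (hℱ : ℱ ≤ 𝒯)
    {X : Type*} [TopologicalSpace X] [PolishSpace X] [MeasurableSpace X] [BorelSpace X]
    [Infinite X] :
    (∀ D : Set T, MeasurableSet[𝒯] D → 0 < μ D →
      ∃ D₀ ⊆ D, MeasurableSet[𝒯] D₀ ∧
        ∀ E : Set T, MeasurableSet[ℱ] E → 0 < μ (symmDiff D₀ (D ∩ E)))
    ↔
    (∀ 𝒢 : MeasurableSpace T, 𝒢 ≤ ℱ →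
      ∀ F : T → Set X,
        MeasurableSet[ℱ.prod inferInstance] {p : T × X | p.2 ∈ F p.1} →
        (∀ᵐ t ∂μ, IsClosed (F t) ∧ (F t).Nonempty) →
        ∀ f₁ f₂ : T → X, Measurable[𝒯] f₁ → Measurable[𝒯] f₂ →
          (∀ᵐ t ∂μ, f₁ t ∈ F t) → (∀ᵐ t ∂μ, f₂ t ∈ F t) →
          ∀ α : ℝ≥0∞, 0 < α → α < 1 →
            ∃ f : T → X, Measurable[𝒯] f ∧ (∀ᵐ t ∂μ, f t ∈ F t) ∧
              ∀ B : Set X, MeasurableSet B → ∀ A : Set T, MeasurableSet[𝒢] A →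
                μ (A ∩ f ⁻¹' B)
                  = α * μ (A ∩ f₁ ⁻¹' B) + (1 - α) * μ (A ∩ f₂ ⁻¹' B)) := by
  have hid : @Measurable T T 𝒯 ℱ id := measurable_id'' hℱ
  constructor
  · intro h 𝒢 h𝒢 F hF _ f₁ f₂ hf₁ hf₂ h₁ h₂ α _ hα1
    have hne : @NowhereEquivalentAlong T T 𝒯 ℱ μ id := h
    obtain ⟨f, hf, hfF, hfB⟩ :=
      @NowhereEquivalentAlong.exists_selection T T 𝒯 ℱ μ id _ hne hid X _ _ _
        {p : T × X | p.2 ∈ F p.1} hF f₁ f₂ hf₁ hf₂ h₁ h₂ α hα1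
    exact ⟨f, hf, hfF, fun B hB A hA => hfB B hB A (h𝒢 A hA)⟩
  · intro hconv
    by_contra hcon
    push Not at hcon
    obtain ⟨D, hD, hpos, hDE⟩ := hcon
    obtain ⟨n, hn⟩ := ENNReal.exists_inv_nat_lt hpos.ne'
    obtain ⟨f, hf, hfx, hfA⟩ := @exists_equidistributed T T 𝒯 ℱ μ id X _ _
      (fun C hC hC' f₁ f₂ hf₁ hf₂ h₁ h₂ α hα0 hα1 => hconv ℱ le_rfl (fun _ => C)
        (@measurable_snd T X ℱ _ C hC.measurableSet) (ae_of_all _ fun _ => ⟨hC.isClosed, hC'⟩)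
        f₁ f₂ hf₁ hf₂ h₁ h₂ α hα0 hα1)
      (Infinite.natEmbedding X) (Infinite.natEmbedding X).injective n
    have hle : μ D ≤ ((n + 1 : ℕ) : ℝ≥0∞)⁻¹ := by
      refine @measure_le_inv_of_equidistributed T T 𝒯 ℱ μ _ id hid D (n + 1)
        (fun i => f ⁻¹' {Infinite.natEmbedding X i}) ?_ ?_ (fun i A hA => hfA i i.2 A hA) ?_
      · intro i j hij
        convert measure_empty (μ := μ)
        refine disjoint_iff_inter_eq_empty.1 (Disjoint.preimage _ (disjoint_singleton.2 fun h => ?_))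
        exact hij (Fin.ext ((Infinite.natEmbedding X).injective h))
      · filter_upwards [hfx] with t ⟨i, hi, hti⟩
        exact ⟨⟨i, hi⟩, hti⟩
      · intro i
        obtain ⟨E, hE, hE0⟩ := hDE _ inter_subset_left
          (hD.inter (hf (measurableSet_singleton (Infinite.natEmbedding X i))))
        exact ⟨E, hE, nonpos_iff_eq_zero.1 hE0⟩
    refine absurd (hle.trans ?_) (not_le.2 hn)
    exact ENNReal.inv_le_inv.2 (by exact_mod_cast Nat.le_succ n)
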